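/- arXiv:1509.03092 — 2 statements merged into one kernel-verified Lean document; each statement's English description precedes it below -/
import Mathlib

section
/- Let G be a cubic (3-regular) simple graph of order n which has an S_{1,2}-decomposition. Then there exists an independent set S ⊆ V(G) such that: (1) |S| ≥ 3n/8; (2) every connected component of G∖S is either a cycle or a tree; and (3) no connected component of G∖S contains two vertices of degree 3 in G∖S. -/
open SimpleGraph

variable {V : Type*}

/-- A (potential) copy of the double-star `S_{1,r-1}` in a graph on vertex set `V`.
`center` is the vertex of degree `r`, `mid` is the vertex of degree 2 (adjacent to `center`),
`pend` is the pendant neighbour of `mid`, and `leaf i` are the `r - 1` pendant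
neighbours of `center`.  For `r = 3` this is the double-star `S_{1,2}`. -/
structure DoubleStarCopy (V : Type*) (r : ℕ) where
  center : V
  mid : V
  pend : V
  leaf : Fin (r - 1) → V

namespace DoubleStarCopy

variable {r : ℕ}

/-- The list of vertices of the copy. -/
def vertList (t : DoubleStarCopy V r) : List V :=
  t.center :: t.mid :: t.pend :: List.ofFn t.leaf

/-- The vertex set of the copy. -/
def verts (t : DoubleStarCopy V r) : Set V := {v | v ∈ t.vertList}

/-- The pendant (degree-one) vertices of the copy. -/
def pendants (t : DoubleStarCopy V r) : Set V := insert t.pend (Set.range t.leaf)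

/-- The edge set of the copy. -/
def edges (t : DoubleStarCopy V r) : Set (Sym2 V) :=
  insert s(t.center, t.mid) (insert s(t.mid, t.pend)
    (Set.range fun i => s(t.center, t.leaf i)))

/-- `t` is a genuine copy of the double-star `S_{1,r-1}` inside `G`:
its vertices are pairwise distinct and all its edges are edges of `G`. -/
def IsCopyIn (G : SimpleGraph V) (t : DoubleStarCopy V r) : Prop :=
  t.vertList.Nodup ∧ t.edges ⊆ G.edgeSet

end DoubleStarCopy

/-- `𝒟` is an `S_{1,r-1}`-decomposition of `G`: every member of `𝒟` is a copy of the
double-star `S_{1,r-1}` in `G`, and every edge of `G` lies in exactly one member of `𝒟`. -/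
def IsDSDecompOf (G : SimpleGraph V) (r : ℕ) (𝒟 : Set (DoubleStarCopy V r)) : Prop :=
  (∀ t ∈ 𝒟, t.IsCopyIn G) ∧ ∀ e ∈ G.edgeSet, ∃! t, t ∈ 𝒟 ∧ e ∈ t.edges

/-- `G` has an `S_{1,r-1}`-decomposition. -/
def HasDSDecomp (G : SimpleGraph V) (r : ℕ) : Prop :=
  ∃ 𝒟 : Set (DoubleStarCopy V r), IsDSDecompOf G r 𝒟

/-- `G` is `(S_{1,r-1}, S)`-decomposable: it has an `S_{1,r-1}`-decomposition in which `S`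
is exactly the set of vertices occurring as the degree-`r` vertex of some copy. -/
def IsDSSDecomposable (G : SimpleGraph V) (r : ℕ) (S : Set V) : Prop :=
  ∃ 𝒟 : Set (DoubleStarCopy V r), IsDSDecompOf G r 𝒟 ∧ S = {v | ∃ t ∈ 𝒟, t.center = v}

/-- `S` is an independent set of `G`. -/
def IsIndepSetIn (G : SimpleGraph V) (S : Set V) : Prop :=
  ∀ ⦃u⦄, u ∈ S → ∀ ⦃v⦄, v ∈ S → ¬ G.Adj u v

/-- The independence number `α(G)`. -/
noncomputable def indepNumber (G : SimpleGraph V) : ℕ :=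
  sSup {k | ∃ S : Set V, IsIndepSetIn G S ∧ S.ncard = k}

/-- `D` is a dominating set of `G`. -/
def IsDomSet (G : SimpleGraph V) (D : Set V) : Prop :=
  ∀ v ∉ D, ∃ d ∈ D, G.Adj v d

/-- The domination number `γ(G)`. -/
noncomputable def domNumber (G : SimpleGraph V) : ℕ :=
  sInf {k | ∃ D : Set V, IsDomSet G D ∧ D.ncard = k}

/-- `N(X)`, the union of the neighbourhoods of the vertices of `X`. -/
def nbhd (G : SimpleGraph V) (X : Set V) : Set V := {v | ∃ x ∈ X, G.Adj x v}

/-- The degree of `v` in the graph `G ∖ S` (for `v ∉ S`). -/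
noncomputable def degIn (G : SimpleGraph V) (S : Set V) (v : V) : ℕ :=
  {w | w ∉ S ∧ G.Adj v w}.ncard

/-- The vertex `v` lies on a cycle of length `k` in `G`. -/
def InCycleOfLength (G : SimpleGraph V) (v : V) (k : ℕ) : Prop :=
  ∃ c : G.Walk v v, c.IsCycle ∧ c.length = k

/-- A graph is a cycle: it has a (genuine, simple) cycle passing through all of
its vertices and using all of its edges. -/
def IsCycleGraph {W : Type*} (H : SimpleGraph W) : Prop :=
  ∃ (v : W) (c : H.Walk v v), c.IsCycle ∧ (∀ x, x ∈ c.support) ∧ ∀ e ∈ H.edgeSet, e ∈ c.edges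

/-- A graph is a path: it has a simple path passing through all of its vertices and
using all of its edges. -/
def IsPathGraph {W : Type*} (H : SimpleGraph W) : Prop :=
  ∃ (u v : W) (p : H.Walk u v), p.IsPath ∧ (∀ x, x ∈ p.support) ∧ ∀ e ∈ H.edgeSet, e ∈ p.edges

/-- `S` is a cycling set of `G`: every connected component of `G ∖ S` is a cycle. -/
def IsCyclingSet (G : SimpleGraph V) (S : Set V) : Prop :=
  ∀ c : (G.induce Sᶜ).ConnectedComponent, IsCycleGraph ((G.induce Sᶜ).induce c.supp)

/-- `(A, B)` is a bipartition of `G`. -/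
def IsBipartitionOf (G : SimpleGraph V) (A B : Set V) : Prop :=
  A ∪ B = Set.univ ∧ Disjoint A B ∧ ∀ ⦃u v⦄, G.Adj u v → (u ∈ A ↔ v ∈ B)

/-- The edge set of the graph `G ∖ S`: edges of `G` avoiding `S`. -/
def removedEdges (G : SimpleGraph V) (S : Set V) : Set (Sym2 V) :=
  {e | e ∈ G.edgeSet ∧ ∀ v ∈ e, v ∉ S}

/-- Adjacency in the auxiliary bipartite graph `H = (S, L)`:
`s ∈ S` is adjacent to the vertex `u_e` corresponding to an edge `e` of `G ∖ S`
iff `G` has an edge with one end `s` whose other end lies on `e`. -/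
def auxAdj (G : SimpleGraph V) (s : V) (e : Sym2 V) : Prop :=
  ∃ w ∈ e, G.Adj s w

/-- The auxiliary bipartite graph `H = (S, L)` has a perfect matching: a bijection
between `S` and the edges of `G ∖ S` matching each `s ∈ S` with an `H`-neighbour. -/
def AuxHasPerfectMatching (G : SimpleGraph V) (S : Set V) : Prop :=
  ∃ m : ↥S ≃ ↥(removedEdges G S), ∀ s : ↥S, auxAdj G (s : V) ((m s : Sym2 V))

/-- A connected graph, all of whose edges are oriented with out-degree at most one and whose
non-sinks have degree at most two, is a cycle or a tree, and has at most one sink. -/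
theorem cycle_or_tree_aux {W : Type*} [Finite W] (H : SimpleGraph W) (hconn : H.Connected)
    (R : W → W → Prop) (hfun : ∀ v w w', R v w → R v w' → w = w')
    (hadj : ∀ v w, H.Adj v w → R v w ∨ R w v)
    (hdeg : ∀ v w, R v w → (H.neighborSet v).ncard ≤ 2) :
    (IsCycleGraph H ∨ H.IsTree) ∧ ∀ u v, (∀ w, ¬ R u w) → (∀ w, ¬ R v w) → u = v := by
  classical
  have := Fintype.ofFinite W
  have hsrc : ∀ e : H.edgeSet, ∃ v w, R v w ∧ (e : Sym2 W) = s(v, w) := by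
    rintro ⟨e, he⟩
    induction e with
    | h a b =>
      rcases hadj a b he with h | h
      · exact ⟨a, b, h, rfl⟩
      · exact ⟨b, a, h, Sym2.eq_swap⟩
  choose src tgt hR he using hsrc
  have hinj : Function.Injective src := by
    intro e e' h
    apply Subtype.ext
    rw [he e, he e', h, hfun (src e') (tgt e) (tgt e') (h ▸ hR e) (hR e')]
  have hle : Fintype.card H.edgeSet ≤ (Finset.univ.filter fun v => ∃ w, R v w).card := by
    rw [← Finset.card_univ]
    apply Finset.card_le_card_of_injOn src
    · intro e _
      simp only [Finset.coe_filter, Finset.mem_univ, true_and, Set.mem_ofPred_eq]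
      exact ⟨_, hR e⟩
    · exact hinj.injOn
  have hsplit := Finset.card_filter_add_card_filter_not (s := (Finset.univ : Finset W))
    (fun v => ∃ w, R v w)
  rw [Finset.card_univ] at hsplit
  have hc := hconn.card_vert_le_card_edgeSet_add_one
  rw [Nat.card_eq_fintype_card, Nat.card_eq_fintype_card] at hc
  refine ⟨?_, ?_⟩
  · by_cases hT : Fintype.card H.edgeSet + 1 = Fintype.card W
    · right
      rw [isTree_iff_connected_and_card, Nat.card_eq_fintype_card, Nat.card_eq_fintype_card]
      exact ⟨hconn, hT⟩
    · left
      have h0 : (Finset.univ.filter fun v => ¬ ∃ w, R v w).card = 0 := by omega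
      have hall : ∀ v, ∃ w, R v w := by
        intro v
        by_contra hv
        rw [Finset.card_eq_zero] at h0
        have : v ∈ (Finset.univ.filter fun v => ¬ ∃ w, R v w) := by simpa using hv
        rw [h0] at this
        simp at this
      have hd2 : ∀ v, H.degree v ≤ 2 := by
        intro v
        obtain ⟨w, hw⟩ := hall v
        have := hdeg v w hw
        rwa [Set.ncard_eq_toFinset_card', Set.toFinset_card, card_neighborSet_eq_degree] at this
      have hsum := H.sum_degrees_eq_twice_card_edges
      rw [edgeFinset_card] at hsum
      have heq : ∀ v, H.degree v = 2 := by
        have hs : ∑ v, H.degree v = ∑ v : W, 2 := by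
          apply le_antisymm (Finset.sum_le_sum fun v _ => hd2 v)
          simp only [Finset.sum_const, Finset.card_univ, smul_eq_mul]
          omega
        have := (Finset.sum_eq_sum_iff_of_le (fun v _ => hd2 v)).1 hs
        exact fun v => this v (Finset.mem_univ v)
      have hcyc : H.IsCycles := by
        intro v _
        rw [Set.ncard_eq_toFinset_card', Set.toFinset_card, card_neighborSet_eq_degree, heq]
      obtain ⟨v⟩ := hconn.nonempty
      obtain ⟨p, hp, hv⟩ := hcyc.exists_cycle_toSubgraph_verts_eq_connectedComponentSupp
        (c := H.connectedComponentMk v) (v := v) rfl (by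
          apply Set.nonempty_of_ncard_ne_zero
          rw [Set.ncard_eq_toFinset_card', Set.toFinset_card, card_neighborSet_eq_degree, heq]
          norm_num)
      have hx : ∀ x, x ∈ p.toSubgraph.verts := by
        intro x
        rw [hv]
        exact ConnectedComponent.sound (hconn.preconnected x v)
      refine ⟨v, p, hp, fun x => p.mem_verts_toSubgraph.1 (hx x), ?_⟩
      intro e hee
      induction e with
      | h a b =>
        rw [← Walk.mem_edges_toSubgraph, Subgraph.mem_edgeSet]
        exact (hp.adj_toSubgraph_iff_of_isCycles hcyc (hx a) b).2 hee
  · intro u v hu hv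
    have h1 : (Finset.univ.filter fun v => ¬ ∃ w, R v w).card ≤ 1 := by omega
    rw [Finset.card_le_one] at h1
    exact h1 u (by simpa using hu) v (by simpa using hv)

/-- If a cubic graph `G` of order `n` has an `S_{1,2}`-decomposition, then
there is an independent set `S` with `|S| ≥ 3n/8` such that every component of `G ∖ S` is a
cycle or a tree, and no component of `G ∖ S` contains two vertices of degree 3 in `G ∖ S`. -/
theorem statement2 {V : Type*} [Fintype V] (G : SimpleGraph V) [DecidableRel G.Adj]
    (n : ℕ) (hn : Fintype.card V = n) (hcubic : G.IsRegularOfDegree 3)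
    (hdec : HasDSDecomp G 3) :
    ∃ S : Set V, IsIndepSetIn G S ∧ 3 * n ≤ 8 * S.ncard ∧
      (∀ c : (G.induce Sᶜ).ConnectedComponent,
        IsCycleGraph ((G.induce Sᶜ).induce c.supp) ∨ ((G.induce Sᶜ).induce c.supp).IsTree) ∧
      (∀ c : (G.induce Sᶜ).ConnectedComponent, ∀ u v : ↥(Sᶜ), u ∈ c.supp → v ∈ c.supp →
        degIn G S ↑u = 3 → degIn G S ↑v = 3 → u = v) := by
  classical
  obtain ⟨D, hcopy, huniq⟩ := hdec
  have huq : ∀ t ∈ D, ∀ t' ∈ D, ∀ e, e ∈ t.edges → e ∈ t'.edges → t = t' := by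
    intro t ht t' ht' e he he'
    exact (huniq e ((hcopy t ht).2 he)).unique ⟨ht, he⟩ ⟨ht', he'⟩
  have hcard3 : ∀ v, (G.neighborFinset v).card = 3 := fun v => hcubic v
  have hcm : ∀ t ∈ D, G.Adj t.center t.mid := fun t ht => (hcopy t ht).2 (Or.inl rfl)
  have hmp : ∀ t ∈ D, G.Adj t.mid t.pend := fun t ht => (hcopy t ht).2 (Or.inr (Or.inl rfl))
  have hcl : ∀ t ∈ D, ∀ i, G.Adj t.center (t.leaf i) :=
    fun t ht i => (hcopy t ht).2 (Or.inr (Or.inr ⟨i, rfl⟩))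
  have hnd : ∀ t ∈ D, t.mid ≠ t.leaf 0 ∧ t.mid ≠ t.leaf 1 ∧ t.leaf 0 ≠ t.leaf 1 ∧
      t.center ≠ t.pend := by
    intro t ht
    have h := (hcopy t ht).1
    have hl : List.ofFn t.leaf = [t.leaf 0, t.leaf 1] := by
      simp [List.ofFn_succ]
    rw [DoubleStarCopy.vertList, hl] at h
    simp at h
    tauto
  -- all edges at a center belong to its copy
  have hstar : ∀ t ∈ D, ∀ w, G.Adj t.center w → s(t.center, w) ∈ t.edges := by
    intro t ht w hw
    obtain ⟨h1, h2, h3, -⟩ := hnd t ht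
    have hsub : ({t.mid, t.leaf 0, t.leaf 1} : Finset V) ⊆ G.neighborFinset t.center := by
      intro x hx
      simp only [Finset.mem_insert, Finset.mem_singleton] at hx
      rw [mem_neighborFinset]
      rcases hx with rfl | rfl | rfl
      · exact hcm t ht
      · exact hcl t ht 0
      · exact hcl t ht 1
    have hc : ({t.mid, t.leaf 0, t.leaf 1} : Finset V).card = 3 :=
      Finset.card_eq_three.2 ⟨_, _, _, h1, h2, h3, rfl⟩
    have heq := Finset.eq_of_subset_of_card_le hsub (by rw [hc, hcard3])
    have hwm : w ∈ ({t.mid, t.leaf 0, t.leaf 1} : Finset V) := by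
      rw [heq, mem_neighborFinset]; exact hw
    simp only [Finset.mem_insert, Finset.mem_singleton] at hwm
    rcases hwm with rfl | rfl | rfl
    · exact Or.inl rfl
    · exact Or.inr (Or.inr ⟨0, rfl⟩)
    · exact Or.inr (Or.inr ⟨1, rfl⟩)
  have hcinj : ∀ t ∈ D, ∀ t' ∈ D, t.center = t'.center → t = t' := by
    intro t ht t' ht' h
    refine huq t ht t' ht' s(t.center, t.mid) (Or.inl rfl) ?_
    have := hcm t ht
    rw [h] at this ⊢
    exact hstar t' ht' _ this
  have hind : ∀ t ∈ D, ∀ t' ∈ D, ¬ G.Adj t.center t'.center := by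
    intro t ht t' ht' h
    have h1 := hstar t ht _ h
    have h2 := hstar t' ht' _ h.symm
    rw [Sym2.eq_swap] at h2
    have := huq t ht t' ht' _ h1 h2
    rw [this] at h
    exact G.loopless.irrefl _ h
  set S : Set V := {v | ∃ t ∈ D, t.center = v} with hS
  have hmS : ∀ t ∈ D, t.mid ∉ S := by
    rintro t ht ⟨t', ht', h⟩
    exact hind t ht t' ht' (h ▸ hcm t ht)
  have hpS : ∀ t ∈ D, t.pend ∉ S := by
    rintro t ht ⟨t', ht', h⟩
    have h1 := hmp t ht
    have h2 : s(t.mid, t.pend) ∈ t'.edges := by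
      rw [← h] at h1 ⊢
      rw [Sym2.eq_swap]
      exact hstar t' ht' _ h1.symm
    have := huq t ht t' ht' _ (Or.inr (Or.inl rfl)) h2
    subst this
    exact (hnd t ht).2.2.2 h
  have hdegle : ∀ t ∈ D, degIn G S t.mid ≤ 2 := by
    intro t ht
    have hs : {w | w ∉ S ∧ G.Adj t.mid w} ⊆
        (((G.neighborFinset t.mid).erase t.center : Finset V) : Set V) := by
      rintro w ⟨hw, ha⟩
      simp only [Finset.coe_erase, Set.mem_sdiff, Set.mem_singleton_iff, Finset.mem_coe,
        mem_neighborFinset]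
      refine ⟨ha, ?_⟩
      rintro rfl
      exact hw ⟨t, ht, rfl⟩
    have h1 := Set.ncard_le_ncard hs (Finset.finite_toSet _)
    rw [Set.ncard_coe_finset, Finset.card_erase_of_mem
      (by rw [mem_neighborFinset]; exact (hcm t ht).symm), hcard3] at h1
    exact h1
  let R : V → V → Prop := fun v w => ∃ t ∈ D, t.mid = v ∧ t.pend = w
  have hRfun : ∀ v w w', R v w → R v w' → w = w' := by
    rintro v w w' ⟨t, ht, rfl, rfl⟩ ⟨t', ht', hm, rfl⟩
    by_contra hne
    have hcne : t.center ≠ t'.center := fun h => hne (by rw [hcinj t ht t' ht' h])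
    have hsub : ({t.center, t'.center, t.pend, t'.pend} : Finset V) ⊆
        G.neighborFinset t.mid := by
      intro x hx
      simp only [Finset.mem_insert, Finset.mem_singleton] at hx
      rw [mem_neighborFinset]
      rcases hx with rfl | rfl | rfl | rfl
      · exact (hcm t ht).symm
      · rw [← hm]; exact (hcm t' ht').symm
      · exact hmp t ht
      · rw [← hm]; exact hmp t' ht'
    have h4 : ({t.center, t'.center, t.pend, t'.pend} : Finset V).card = 4 := by
      have a : ∀ x ∈ D, ∀ y ∈ D, x.center ≠ y.pend :=
        fun x hx y hy h => hpS y hy ⟨x, hx, h⟩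
      rw [Finset.card_insert_of_notMem, Finset.card_insert_of_notMem,
        Finset.card_insert_of_notMem, Finset.card_singleton]
      · simpa using hne
      · simp [a t' ht' t ht, a t' ht' t' ht']
      · simp [hcne, a t ht t ht, a t ht t' ht']
    have := Finset.card_le_card hsub
    rw [h4, hcard3] at this
    omega
  have hRadj : ∀ v w, v ∉ S → w ∉ S → G.Adj v w → R v w ∨ R w v := by
    intro v w hv hw h
    obtain ⟨t, ⟨ht, he⟩, -⟩ := huniq s(v, w) h
    have hc : ∀ x, s(v, w) = s(t.center, x) → False := by
      intro x hx
      rcases Sym2.eq_iff.1 hx with ⟨h1, -⟩ | ⟨-, h1⟩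
      · exact hv ⟨t, ht, h1.symm⟩
      · exact hw ⟨t, ht, h1.symm⟩
    rcases he with he | he | ⟨i, he⟩
    · exact (hc _ he).elim
    · rcases Sym2.eq_iff.1 he with ⟨h1, h2⟩ | ⟨h1, h2⟩
      · exact Or.inl ⟨t, ht, h1.symm, h2.symm⟩
      · exact Or.inr ⟨t, ht, h2.symm, h1.symm⟩
    · exact (hc _ he.symm).elim
  have hcomp : ∀ c : (G.induce Sᶜ).ConnectedComponent,
      (IsCycleGraph ((G.induce Sᶜ).induce c.supp) ∨ ((G.induce Sᶜ).induce c.supp).IsTree) ∧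
      ∀ u v : c.supp, (∀ w : c.supp, ¬ R u.1 w.1) → (∀ w : c.supp, ¬ R v.1 w.1) → u = v := by
    intro c
    apply cycle_or_tree_aux _ c.connected_toSimpleGraph (fun v w => R v.1 w.1)
    · intro v w w' h h'
      exact Subtype.ext (Subtype.ext (hRfun _ _ _ h h'))
    · intro v w h
      exact hRadj _ _ v.1.2 w.1.2 h
    · rintro v w ⟨t, ht, h1, h2⟩
      refine le_trans ?_ (hdegle t ht)
      rw [degIn, h1]
      apply Set.ncard_le_ncard_of_injOn (fun x => x.1.1)
      · intro x hx
        exact ⟨x.1.2, hx⟩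
      · intro x _ y _ h
        exact Subtype.ext (Subtype.ext h)
  refine ⟨S, ?_, ?_, fun c => (hcomp c).1, ?_⟩
  · rintro u ⟨t, ht, rfl⟩ v ⟨t', ht', rfl⟩
    exact hind t ht t' ht'
  · have hch : ∀ v : V, ∃ t : DoubleStarCopy V 3, v ∈ S → t ∈ D ∧ t.center = v := by
      intro v
      by_cases hv : v ∈ S
      · obtain ⟨t, h⟩ := hv
        exact ⟨t, fun _ => h⟩
      · exact ⟨⟨v, v, v, fun _ => v⟩, fun h => (hv h).elim⟩
    choose T hT using hch
    have hsub : G.edgeFinset ⊆ S.toFinset.biUnion fun v =>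
        {s((T v).center, (T v).mid), s((T v).mid, (T v).pend),
          s((T v).center, (T v).leaf 0), s((T v).center, (T v).leaf 1)} := by
      intro e he
      rw [mem_edgeFinset] at he
      obtain ⟨t, ⟨ht, he⟩, -⟩ := huniq e he
      have hcS : t.center ∈ S := ⟨t, ht, rfl⟩
      have hTt : T t.center = t := hcinj _ (hT _ hcS).1 _ ht (hT _ hcS).2
      rw [Finset.mem_biUnion]
      refine ⟨t.center, by simpa using hcS, ?_⟩
      rw [hTt]
      simp only [Finset.mem_insert, Finset.mem_singleton]
      rcases he with he | he | ⟨i, he⟩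
      · exact Or.inl he
      · exact Or.inr (Or.inl he)
      · change Fin 2 at i
        fin_cases i
        · exact Or.inr (Or.inr (Or.inl he.symm))
        · exact Or.inr (Or.inr (Or.inr he.symm))
    have h1 := (Finset.card_le_card hsub).trans
      (Finset.card_biUnion_le_card_mul _ _ 4 fun v _ => Finset.card_le_four)
    have h2 := G.sum_degrees_eq_twice_card_edges
    have h3 : ∑ v, G.degree v = n * 3 := by
      rw [Finset.sum_congr rfl fun v _ => hcubic v]
      simp [hn]
    rw [Set.ncard_eq_toFinset_card']
    omega
  · intro c u v hu hv hdu hdv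
    have key : ∀ x : ↥(Sᶜ), degIn G S x = 3 → ∀ w : V, ¬ R x.1 w := by
      rintro x hx w ⟨t, ht, h1, -⟩
      have := hdegle t ht
      rw [h1] at this
      omega
    have := (hcomp c).2 ⟨u, hu⟩ ⟨v, hv⟩ (fun w => key u hdu _) (fun w => key v hdv _)
    exact congrArg Subtype.val this
end

section
/- Let G be a cubic (3-regular) simple graph of order n with independence number α(G) = 3n/8. Suppose there exists an independent set S ⊆ V(G) with |S| = 3n/8 such that no vertex of S is contained in a cycle of length 3, 5 or 7 in G. Then G is (S_{1,2}, S)-decomposable. -/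
open SimpleGraph

variable {V : Type*}

theorem cyc3 {V : Type*} (G : SimpleGraph V) (s a b : V) (h1 : G.Adj s a) (h2 : G.Adj a b)
    (h3 : G.Adj b s) : InCycleOfLength G s 3 := by
  refine ⟨Walk.cons h1 (Walk.cons h2 (Walk.cons h3 Walk.nil)), ?_, rfl⟩
  have := h1.ne; have := h2.ne; have := h3.ne
  simp [Walk.cons_isCycle_iff, Walk.cons_isPath_iff]
  grind

theorem cyc5 {V : Type*} (G : SimpleGraph V) (s a b c d : V) (h1 : G.Adj s a) (h2 : G.Adj a b)
    (h3 : G.Adj b c) (h4 : G.Adj c d) (h5 : G.Adj d s) (hn : [s, a, b, c, d].Nodup) :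
    InCycleOfLength G s 5 := by
  refine ⟨Walk.cons h1 (Walk.cons h2 (Walk.cons h3 (Walk.cons h4 (Walk.cons h5 Walk.nil)))), ?_, rfl⟩
  simp at hn
  simp [Walk.cons_isCycle_iff, Walk.cons_isPath_iff]
  grind

theorem cyc7 {V : Type*} (G : SimpleGraph V) (s a b c d e f : V) (h1 : G.Adj s a) (h2 : G.Adj a b)
    (h3 : G.Adj b c) (h4 : G.Adj c d) (h5 : G.Adj d e) (h6 : G.Adj e f) (h7 : G.Adj f s)
    (hn : [s, a, b, c, d, e, f].Nodup) :
    InCycleOfLength G s 7 := by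
  refine ⟨Walk.cons h1 (Walk.cons h2 (Walk.cons h3 (Walk.cons h4 (Walk.cons h5
    (Walk.cons h6 (Walk.cons h7 Walk.nil)))))), ?_, rfl⟩
  simp at hn
  simp [Walk.cons_isCycle_iff, Walk.cons_isPath_iff]
  grind

/-- Exchange property of a maximum independent set. -/
theorem exch {V : Type*} [Fintype V] [DecidableEq V] (G : SimpleGraph V) (S : Set V)
    (hind : IsIndepSetIn G S) (hmax : indepNumber G = S.ncard) (B T : Finset V)
    (hB : ∀ b ∈ B, b ∉ S) (hI : ∀ b ∈ B, ∀ b' ∈ B, ¬ G.Adj b b')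
    (hT : ∀ b ∈ B, ∀ s ∈ S, G.Adj b s → s ∈ T) : B.card ≤ T.card := by
  have h1 : ((S \ (T : Set V)) ∪ (B : Set V)).ncard ≤ indepNumber G := by
    apply le_csSup
    · refine ⟨Fintype.card V, ?_⟩
      rintro k ⟨X, -, rfl⟩
      rw [← Nat.card_eq_fintype_card, ← Set.ncard_univ]
      exact Set.ncard_le_ncard (Set.subset_univ _) (Set.toFinite _)
    · refine ⟨_, ?_, rfl⟩
      rintro u (⟨hu, hu'⟩ | hu) v (⟨hv, hv'⟩ | hv) huv
      · exact hind hu hv huv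
      · exact hu' (hT v hv u hu huv.symm)
      · exact hv' (hT u hu v hv huv)
      · exact hI u hu v hv huv
  rw [Set.ncard_union_eq (by
    rw [Set.disjoint_left]
    rintro a ⟨ha, -⟩ hb
    exact hB a hb ha) (Set.toFinite _) (Set.toFinite _), Set.ncard_coe_finset] at h1
  have h2 := Set.le_ncard_sdiff (T : Set V) S (Set.toFinite _)
  rw [Set.ncard_coe_finset] at h2
  omega

/-- `v` lies outside `S`, and `s ∈ S` is its only neighbour in `S`. -/
def Priv {V : Type*} (G : SimpleGraph V) (S : Set V) (v s : V) : Prop :=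
  v ∉ S ∧ s ∈ S ∧ G.Adj v s ∧ ∀ t ∈ S, G.Adj v t → t = s

/-- `x` lies outside `S` and its neighbours in `S` are exactly `s`, `t`, distinct. -/
def Two {V : Type*} (G : SimpleGraph V) (S : Set V) (x s t : V) : Prop :=
  x ∉ S ∧ s ∈ S ∧ t ∈ S ∧ s ≠ t ∧ G.Adj x s ∧ G.Adj x t ∧ ∀ u ∈ S, G.Adj x u → u = s ∨ u = t

section
variable {V : Type*} [Fintype V] [DecidableEq V] (G : SimpleGraph V) (S : Set V)

theorem L1
    (hM : ∀ B T : Finset V, (∀ b ∈ B, b ∉ S) → (∀ b ∈ B, ∀ b' ∈ B, ¬ G.Adj b b') →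
      (∀ b ∈ B, ∀ s ∈ S, G.Adj b s → s ∈ T) → B.card ≤ T.card)
    (h3 : ∀ s ∈ S, ¬ InCycleOfLength G s 3)
    {v w s : V} (hv : Priv G S v s) (hw : Priv G S w s) : v = w := by
  obtain ⟨v1, v2, v3, v4⟩ := hv
  obtain ⟨w1, w2, w3, w4⟩ := hw
  by_contra hne
  have hvw : ¬ G.Adj v w := fun h => h3 s v2 (cyc3 G s v w v3.symm h w3)
  have := hM {v, w} {s} (by simp; grind)
    (by simp [hvw, show ¬ G.Adj w v from fun h => hvw h.symm]) (by simp; grind)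
  rw [Finset.card_pair hne] at this
  simp at this

theorem L2
    (hM : ∀ B T : Finset V, (∀ b ∈ B, b ∉ S) → (∀ b ∈ B, ∀ b' ∈ B, ¬ G.Adj b b') →
      (∀ b ∈ B, ∀ s ∈ S, G.Adj b s → s ∈ T) → B.card ≤ T.card)
    (h3 : ∀ s ∈ S, ¬ InCycleOfLength G s 3)
    (h5 : ∀ s ∈ S, ¬ InCycleOfLength G s 5)
    {x s t v w : V} (hx : Two G S x s t) (hv : Priv G S v s) (hw : Priv G S w t) : False := by
  obtain ⟨v1, v2, v3, v4⟩ := hv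
  obtain ⟨w1, w2, w3, w4⟩ := hw
  obtain ⟨x1, x2, x3, x4, x5, x6, x7⟩ := hx
  have hxv : x ≠ v := by rintro rfl; exact x4 (v4 t x3 x6).symm
  have hxw : x ≠ w := by rintro rfl; exact x4 (w4 s x2 x5)
  have hvw : v ≠ w := by rintro rfl; exact x4 (w4 s v2 v3)
  have a1 : ¬ G.Adj x v := fun h => h3 s v2 (cyc3 G s x v x5.symm h v3)
  have a2 : ¬ G.Adj x w := fun h => h3 t w2 (cyc3 G t x w x6.symm h w3)
  have a3 : ¬ G.Adj v w := fun h => h5 s v2 (cyc5 G s v w t x v3.symm h w3 x6.symm x5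
    (by simp; grind))
  have := hM {x, v, w} {s, t} (by simp; grind)
    (by simp [a1, a2, a3, show ¬ G.Adj v x from fun h => a1 h.symm, show ¬ G.Adj w x from fun h => a2 h.symm,
      show ¬ G.Adj w v from fun h => a3 h.symm]) (by simp; grind)
  rw [Finset.card_eq_three.2 ⟨x, v, w, hxv, hxw, hvw, rfl⟩, Finset.card_pair x4] at this
  omega

theorem L3
    (hM : ∀ B T : Finset V, (∀ b ∈ B, b ∉ S) → (∀ b ∈ B, ∀ b' ∈ B, ¬ G.Adj b b') →
      (∀ b ∈ B, ∀ s ∈ S, G.Adj b s → s ∈ T) → B.card ≤ T.card)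
    (h3 : ∀ s ∈ S, ¬ InCycleOfLength G s 3)
    (h5 : ∀ s ∈ S, ¬ InCycleOfLength G s 5)
    (h7 : ∀ s ∈ S, ¬ InCycleOfLength G s 7)
    {x y s t u v w : V} (hx : Two G S x s t) (hy : Two G S y s u)
    (hv : Priv G S v t) (hw : Priv G S w u) : x = y := by
  by_contra hxy
  have hL1 := @L1 V _ _ G S hM h3 v w
  have hv0 := hv
  have hw0 := hw
  obtain ⟨v1, v2, v3, v4⟩ := hv
  obtain ⟨w1, w2, w3, w4⟩ := hw
  obtain ⟨x1, x2, x3, x4, x5, x6, x7⟩ := hx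
  obtain ⟨y1, y2, y3, y4, y5, y6, y7⟩ := hy
  have hxv : x ≠ v := by rintro rfl; exact x4 (v4 s x2 x5)
  have hyv : y ≠ v := by rintro rfl; exact x4 (v4 s x2 y5)
  have hxw : x ≠ w := by rintro rfl; exact y4 (w4 s x2 x5)
  have hyw : y ≠ w := by rintro rfl; exact y4 (w4 s x2 y5)
  have a0 : ¬ G.Adj x y := fun h => h3 s x2 (cyc3 G s x y x5.symm h y5)
  have a1 : ¬ G.Adj x v := fun h => h3 t v2 (cyc3 G t x v x6.symm h v3)
  have a2 : ¬ G.Adj y w := fun h => h3 u w2 (cyc3 G u y w y6.symm h w3)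
  by_cases htu : t = u
  · subst htu
    obtain rfl := hL1 hv0 hw0
    have := hM {x, y, v} {s, t} (by simp; grind)
      (by simp [a0, a1, a2, show ¬ G.Adj y x from fun h => a0 h.symm, show ¬ G.Adj v x from fun h => a1 h.symm,
        show ¬ G.Adj v y from fun h => a2 h.symm]) (by simp; grind)
    rw [Finset.card_eq_three.2 ⟨x, y, v, hxy, hxv, hyv, rfl⟩, Finset.card_pair x4] at this
    omega
  · have hvw : v ≠ w := by rintro rfl; exact htu (w4 t v2 v3)
    have a3 : ¬ G.Adj x w := fun h => h5 s x2 (cyc5 G s x w u y x5.symm h w3 y6.symm y5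
      (by simp; grind))
    have a4 : ¬ G.Adj y v := fun h => h5 s x2 (cyc5 G s y v t x y5.symm h v3 x6.symm x5
      (by simp; grind))
    have a5 : ¬ G.Adj v w := fun h => h7 s x2 (cyc7 G s x t v w u y x5.symm x6 v3.symm h w3
      y6.symm y5 (by
        have hne : ∀ p ∈ S, ∀ q, q ∉ S → p ≠ q := fun p hp q hq hpq => hq (hpq ▸ hp)
        simp [hne s x2 x x1, x4, hne s x2 v v1, hne s x2 w w1, y4, hne s x2 y y1,
          (hne t x3 x x1).symm, hxv, hxw, (hne u y3 x x1).symm, hxy, hne t x3 v v1, hne t x3 w w1,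
          htu, hne t x3 y y1, hvw, (hne u y3 v v1).symm, hyv.symm, (hne u y3 w w1).symm,
          hyw.symm, hne u y3 y y1]))
    have := hM {x, y, v, w} {s, t, u} (by simp; grind)
      (by simp [a0, a1, a2, a3, a4, a5, show ¬ G.Adj y x from fun h => a0 h.symm,
        show ¬ G.Adj v x from fun h => a1 h.symm,
        show ¬ G.Adj w y from fun h => a2 h.symm, show ¬ G.Adj w x from fun h => a3 h.symm,
        show ¬ G.Adj v y from fun h => a4 h.symm, show ¬ G.Adj w v from fun h => a5 h.symm]) (by simp; grind)
    rw [Finset.card_eq_three.2 ⟨s, t, u, x4, y4, htu, rfl⟩, Finset.card_insert_of_notMem,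
      Finset.card_eq_three.2 ⟨y, v, w, hyv, hyw, hvw, rfl⟩] at this
    · omega
    · simp; grind

end


section
open Classical in
/-- Neighbours of `v` inside `S`. -/
noncomputable def nbrS {V : Type*} [Fintype V] (G : SimpleGraph V) (S : Set V) (v : V) :
    Finset V := Finset.univ.filter (fun s => s ∈ S ∧ G.Adj v s)

open Classical in
/-- Neighbours of `v` outside `S`. -/
noncomputable def nbrC {V : Type*} [Fintype V] (G : SimpleGraph V) (S : Set V) (v : V) :
    Finset V := Finset.univ.filter (fun s => s ∉ S ∧ G.Adj v s)

open Classical in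
/-- The fractional matching weights. -/
noncomputable def wt {V : Type*} [Fintype V] (G : SimpleGraph V) (S : Set V) (v s : V) : ℕ :=
  if ∃ t, Priv G S v t then 4
  else if (nbrC G S v).card = 1 then
    (if ∃ w, Priv G S w s then 0
     else if ∃ t, t ∈ S ∧ G.Adj v t ∧ ∃ w, Priv G S w t then 2 else 1)
  else 0

variable {V : Type*} [Fintype V] [DecidableEq V] (G : SimpleGraph V) [DecidableRel G.Adj]
  (S : Set V)

theorem nbr_card (hcubic : G.IsRegularOfDegree 3) (v : V) :
    (nbrS G S v).card + (nbrC G S v).card = 3 := by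
  classical
  rw [← hcubic v, ← G.card_neighborFinset_eq_degree, ← Finset.card_union_of_disjoint]
  · congr 1
    ext w
    simp [nbrS, nbrC]
    tauto
  · rw [Finset.disjoint_left]
    intro w
    simp [nbrS, nbrC]
    tauto

theorem priv_of_card {v s : V} (hv : v ∉ S) (h : nbrS G S v = {s}) : Priv G S v s := by
  have h' : ∀ t, (t ∈ S ∧ G.Adj v t) ↔ t = s := by
    intro t
    have := congrArg (t ∈ ·) h
    simpa [nbrS] using this
  exact ⟨hv, ((h' s).2 rfl).1, ((h' s).2 rfl).2, fun t h1 h2 => (h' t).1 ⟨h1, h2⟩⟩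

theorem two_of_card {v s t : V} (hv : v ∉ S) (hst : s ≠ t) (h : nbrS G S v = {s, t}) :
    Two G S v s t := by
  have h' : ∀ u, (u ∈ S ∧ G.Adj v u) ↔ u = s ∨ u = t := by
    intro u
    have := congrArg (u ∈ ·) h
    simpa [nbrS] using this
  have h1 := (h' s).2 (Or.inl rfl)
  have h2 := (h' t).2 (Or.inr rfl)
  exact ⟨hv, h1.1, h2.1, hst, h1.2, h2.2, fun u a b => (h' u).1 ⟨a, b⟩⟩

theorem wt_out (hcubic : G.IsRegularOfDegree 3)
    (hM : ∀ B T : Finset V, (∀ b ∈ B, b ∉ S) → (∀ b ∈ B, ∀ b' ∈ B, ¬ G.Adj b b') →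
      (∀ b ∈ B, ∀ s ∈ S, G.Adj b s → s ∈ T) → B.card ≤ T.card)
    (h3 : ∀ s ∈ S, ¬ InCycleOfLength G s 3)
    (h5 : ∀ s ∈ S, ¬ InCycleOfLength G s 5)
    {v : V} (hv : v ∉ S) :
    2 * (nbrC G S v).card ≤ ∑ s ∈ nbrS G S v, wt G S v s := by
  have hc := nbr_card G S hcubic v
  have h0 : (nbrS G S v).card ≠ 0 := by
    intro h
    rw [Finset.card_eq_zero] at h
    have := hM {v} ∅ (by simpa using hv) (by simp) (by
      intro b hb s hs hbs
      rw [Finset.mem_singleton] at hb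
      subst hb
      have : s ∈ nbrS G S b := by simp [nbrS, hs, hbs]
      rw [h] at this
      exact this)
    simp at this
  have hcases : (nbrS G S v).card = 1 ∨ (nbrS G S v).card = 2 ∨ (nbrS G S v).card = 3 := by omega
  rcases hcases with h | h | h
  · obtain ⟨s, hs⟩ := Finset.card_eq_one.1 h
    have hp := priv_of_card G S hv hs
    have : wt G S v s = 4 := by
      unfold wt
      rw [if_pos ⟨s, hp⟩]
    rw [hs, Finset.sum_singleton, this]
    omega
  · obtain ⟨s, t, hst, hs⟩ := Finset.card_eq_two.1 h
    have hT := two_of_card G S hv hst hs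
    have hnp : ¬ ∃ u, Priv G S v u := by
      rintro ⟨u, p1, p2, p3, p4⟩
      obtain ⟨x1, x2, x3, x4, x5, x6, x7⟩ := hT
      exact x4 ((p4 s x2 x5).trans (p4 t x3 x6).symm)
    have hd : (nbrC G S v).card = 1 := by omega
    have hno : ¬ ((∃ w, Priv G S w s) ∧ (∃ w, Priv G S w t)) := by
      rintro ⟨⟨w, hw⟩, ⟨w', hw'⟩⟩
      exact L2 G S hM h3 h5 hT hw hw'
    rw [hs, Finset.sum_pair hst, hd]
    obtain ⟨x1, x2, x3, x4, x5, x6, x7⟩ := hT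
    unfold wt
    rw [if_neg hnp, if_pos hd, if_neg hnp, if_pos hd]
    by_cases hA : ∃ w, Priv G S w s
    · have hB : ¬ ∃ w, Priv G S w t := fun hB => hno ⟨hA, hB⟩
      rw [if_pos hA, if_neg hB, if_pos ⟨s, x2, x5, hA⟩]
    · rw [if_neg hA]
      by_cases hB : ∃ w, Priv G S w t
      · rw [if_pos hB, if_pos ⟨t, x3, x6, hB⟩]
      · rw [if_neg hB]
        split_ifs <;> omega
  · have : (nbrC G S v).card = 0 := by omega
    rw [this]
    simp

theorem wt_in (hcubic : G.IsRegularOfDegree 3) (hind : IsIndepSetIn G S)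
    (hM : ∀ B T : Finset V, (∀ b ∈ B, b ∉ S) → (∀ b ∈ B, ∀ b' ∈ B, ¬ G.Adj b b') →
      (∀ b ∈ B, ∀ s ∈ S, G.Adj b s → s ∈ T) → B.card ≤ T.card)
    (h3 : ∀ s ∈ S, ¬ InCycleOfLength G s 3)
    (h5 : ∀ s ∈ S, ¬ InCycleOfLength G s 5)
    (h7 : ∀ s ∈ S, ¬ InCycleOfLength G s 7)
    {s : V} (hs : s ∈ S) :
    ∑ v ∈ G.neighborFinset s, wt G S v s ≤ 4 := by
  have hle : ∀ v, wt G S v s ≤ 4 := by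
    intro v
    unfold wt
    split_ifs <;> omega
  by_cases hw : ∃ w, Priv G S w s
  · obtain ⟨w, hw⟩ := hw
    rw [Finset.sum_eq_single w]
    · exact hle w
    · intro v hv hvw
      rw [G.mem_neighborFinset] at hv
      have hnp : ¬ ∃ t, Priv G S v t := by
        rintro ⟨t, ht⟩
        have := ht.2.2.2 s hs hv.symm
        subst this
        exact hvw (L1 G S hM h3 ht hw)
      unfold wt
      rw [if_neg hnp, if_pos (⟨w, hw⟩ : ∃ w, Priv G S w s)]
      simp
    · intro h
      exact absurd ((G.mem_neighborFinset s w).2 hw.2.2.1.symm) h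
  · have hnp : ∀ v, G.Adj s v → ¬ ∃ t, Priv G S v t := by
      rintro v hv ⟨t, ht⟩
      have := ht.2.2.2 s hs hv.symm
      subst this
      exact hw ⟨v, ht⟩
    have hle2 : ∀ v, G.Adj s v → wt G S v s ≤ 2 := by
      intro v hv
      unfold wt
      rw [if_neg (hnp v hv)]
      split_ifs <;> omega
    have heq2 : ∀ v, G.Adj s v → wt G S v s = 2 → ∃ t w, Two G S v s t ∧ Priv G S w t := by
      intro v hv h
      unfold wt at h
      rw [if_neg (hnp v hv), if_neg hw] at h
      split_ifs at h with hd ht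
      on_goal 2 => omega
      obtain ⟨t, ht1, ht2, w, ht3⟩ := ht
      have hst : s ≠ t := by
        rintro rfl
        exact hw ⟨w, ht3⟩
      have hcc := nbr_card G S hcubic v
      refine ⟨t, w, two_of_card G S (fun hvS => hind hs hvS hv) hst ?_, ht3⟩
      symm
      apply Finset.eq_of_subset_of_card_le
      · intro u hu
        simp only [Finset.mem_insert, Finset.mem_singleton] at hu
        rcases hu with rfl | rfl
        · simp [nbrS, hs, hv.symm]
        · simp [nbrS, ht1, ht2]
      · rw [Finset.card_pair hst]
        omega
    have hpair : ∀ a b, G.Adj s a → G.Adj s b → a ≠ b → ¬ (wt G S a s = 2 ∧ wt G S b s = 2) := by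
      rintro a b ha hb hab ⟨h1, h2⟩
      obtain ⟨t, w, p1, p2⟩ := heq2 a ha h1
      obtain ⟨t', w', q1, q2⟩ := heq2 b hb h2
      exact hab (L3 G S hM h3 h5 h7 p1 q1 p2 q2)
    have hcard : (G.neighborFinset s).card = 3 := by
      rw [G.card_neighborFinset_eq_degree]; exact hcubic s
    obtain ⟨a, b, c, hab, hac, hbc, habc⟩ := Finset.card_eq_three.1 hcard
    have ha : G.Adj s a := by rw [← G.mem_neighborFinset, habc]; simp
    have hb : G.Adj s b := by rw [← G.mem_neighborFinset, habc]; simp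
    have hc : G.Adj s c := by rw [← G.mem_neighborFinset, habc]; simp
    rw [habc, Finset.sum_insert (by simp [hab, hac]), Finset.sum_pair hbc]
    have := hle2 a ha
    have := hle2 b hb
    have := hle2 c hc
    have := hpair a b ha hb hab
    have := hpair a c ha hc hac
    have := hpair b c hb hc hbc
    omega

/-- The Hall condition for the auxiliary bipartite graph. -/
theorem hall_cond (hcubic : G.IsRegularOfDegree 3) (hind : IsIndepSetIn G S)
    (hM : ∀ B T : Finset V, (∀ b ∈ B, b ∉ S) → (∀ b ∈ B, ∀ b' ∈ B, ¬ G.Adj b b') →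
      (∀ b ∈ B, ∀ s ∈ S, G.Adj b s → s ∈ T) → B.card ≤ T.card)
    (h3 : ∀ s ∈ S, ¬ InCycleOfLength G s 3)
    (h5 : ∀ s ∈ S, ¬ InCycleOfLength G s 5)
    (h7 : ∀ s ∈ S, ¬ InCycleOfLength G s 7)
    (F : Finset (Sym2 V)) (hF : ∀ e ∈ F, e ∈ removedEdges G S) (N : Finset V)
    (hN : ∀ e ∈ F, ∀ s ∈ S, auxAdj G s e → s ∈ N) (hNS : ∀ s ∈ N, s ∈ S) :
    F.card ≤ N.card := by
  classical
  let W : Finset V := Finset.univ.filter (fun v => ∃ e ∈ F, v ∈ e)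
  have hWS : ∀ v ∈ W, v ∉ S := by
    intro v hv
    obtain ⟨e, he, hve⟩ := (Finset.mem_filter.1 hv).2
    exact (hF e he).2 v hve
  -- incidences, counted along edges
  have c1 : 2 * F.card = ∑ v ∈ W, (F.filter (fun e => v ∈ e)).card := by
    have : ∑ v ∈ W, (F.filter (fun e => v ∈ e)).card
        = ∑ e ∈ F, (W.filter (fun v => v ∈ e)).card :=
      Finset.sum_card_bipartiteAbove_eq_sum_card_bipartiteBelow (fun v e => v ∈ e)
    rw [this, Finset.sum_congr rfl (g := fun _ => 2), Finset.sum_const, smul_eq_mul, mul_comm]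
    intro e he
    have hdiag : ¬ e.IsDiag := G.not_isDiag_of_mem_edgeSet (hF e he).1
    rw [← Sym2.card_toFinset_of_not_isDiag e hdiag]
    congr 1
    ext v
    simp only [Finset.mem_filter, Sym2.mem_toFinset, W, Finset.mem_univ, true_and]
    exact ⟨fun h => h.2, fun h => ⟨⟨e, he, h⟩, h⟩⟩
  have c2 : ∀ v ∈ W, (F.filter (fun e => v ∈ e)).card ≤ (nbrC G S v).card := by
    intro v hv
    refine (Finset.card_le_card (t := (nbrC G S v).image (fun w => s(v, w))) ?_).trans
      Finset.card_image_le
    intro e he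
    rw [Finset.mem_filter] at he
    obtain ⟨w, rfl⟩ := Sym2.mem_iff_exists.1 he.2
    have h := hF _ he.1
    refine Finset.mem_image.2 ⟨w, ?_, rfl⟩
    simp only [nbrC, Finset.mem_filter, Finset.mem_univ, true_and]
    exact ⟨h.2 w (by simp), h.1⟩
  have c3 : ∑ v ∈ W, ∑ s ∈ nbrS G S v, wt G S v s ≤ ∑ s ∈ N, ∑ v ∈ G.neighborFinset s, wt G S v s := by
    rw [Finset.sum_comm' (t' := N) (s' := fun s => W.filter (fun v => G.Adj v s))]
    · apply Finset.sum_le_sum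
      intro s hs
      apply Finset.sum_le_sum_of_subset
      intro v hv
      rw [G.mem_neighborFinset]
      exact (Finset.mem_filter.1 hv).2.symm
    · intro v s
      simp only [nbrS, Finset.mem_filter, Finset.mem_univ, true_and]
      constructor
      · rintro ⟨hv, hs, hvs⟩
        obtain ⟨e, he, hve⟩ := (Finset.mem_filter.1 hv).2
        exact ⟨⟨hv, hvs⟩, hN e he s hs ⟨v, hve, hvs.symm⟩⟩
      · rintro ⟨⟨hv, hvs⟩, hs⟩
        exact ⟨hv, hNS s hs, hvs⟩
  have c4 : ∑ s ∈ N, ∑ v ∈ G.neighborFinset s, wt G S v s ≤ N.card * 4 := by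
    apply Finset.sum_le_card_nsmul
    intro s hs
    exact wt_in G S hcubic hind hM h3 h5 h7 (hNS s hs)
  have c5 : ∑ v ∈ W, 2 * (F.filter (fun e => v ∈ e)).card
      ≤ ∑ v ∈ W, ∑ s ∈ nbrS G S v, wt G S v s := by
    apply Finset.sum_le_sum
    intro v hv
    have := c2 v hv
    have := wt_out G S hcubic hM h3 h5 (hWS v hv)
    omega
  rw [← Finset.mul_sum, ← c1] at c5
  omega

theorem removed_card (hcubic : G.IsRegularOfDegree 3) (hind : IsIndepSetIn G S)
    (hcard : 8 * S.ncard = 3 * Fintype.card V) : (removedEdges G S).ncard = S.ncard := by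
  classical
  have hE : ∑ v, G.degree v = 2 * G.edgeFinset.card := G.sum_degrees_eq_twice_card_edges
  rw [Finset.sum_congr rfl (fun v _ => hcubic v)] at hE
  simp only [Finset.sum_const, Finset.card_univ, smul_eq_mul] at hE
  let I : Finset (Sym2 V) := S.toFinset.biUnion (fun s => G.incidenceFinset s)
  have hI : I.card = S.ncard * 3 := by
    rw [Finset.card_biUnion, Finset.sum_congr rfl (g := fun _ => 3), Finset.sum_const, smul_eq_mul,
      Set.ncard_eq_toFinset_card']
    · intro s _
      rw [G.card_incidenceFinset_eq_degree]; exact hcubic s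
    · intro a ha b hb hab
      rw [Finset.mem_coe, Set.mem_toFinset] at ha hb
      refine Finset.disjoint_left.2 ?_
      intro e he he'
      rw [G.mem_incidenceFinset] at he he'
      have : e = s(a, b) := (Sym2.mem_and_mem_iff hab).1 ⟨he.2, he'.2⟩
      have h := he.1
      rw [this] at h
      exact hind ha hb h
  have hL : removedEdges G S = ((G.edgeFinset \ I : Finset (Sym2 V)) : Set (Sym2 V)) := by
    ext e
    simp only [removedEdges, Set.mem_ofPred_eq, Finset.coe_sdiff, Set.mem_sdiff, Finset.mem_coe,
      G.mem_edgeFinset, I, Finset.mem_biUnion, Set.mem_toFinset, G.mem_incidenceFinset]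
    constructor
    · rintro ⟨h1, h2⟩
      refine ⟨h1, ?_⟩
      rintro ⟨s, hs, hse⟩
      exact h2 s hse.2 hs
    · rintro ⟨h1, h2⟩
      exact ⟨h1, fun v hv hvS => h2 ⟨v, hvS, h1, hv⟩⟩
  have hsub : I ⊆ G.edgeFinset := by
    intro e he
    obtain ⟨s, _, hs⟩ := Finset.mem_biUnion.1 he
    rw [G.mem_incidenceFinset] at hs
    exact G.mem_edgeFinset.2 hs.1
  have := Finset.card_sdiff_add_card_eq_card hsub
  rw [hL, Set.ncard_coe_finset]
  omega

theorem exists_pm (hcubic : G.IsRegularOfDegree 3) (hind : IsIndepSetIn G S)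
    (hM : ∀ B T : Finset V, (∀ b ∈ B, b ∉ S) → (∀ b ∈ B, ∀ b' ∈ B, ¬ G.Adj b b') →
      (∀ b ∈ B, ∀ s ∈ S, G.Adj b s → s ∈ T) → B.card ≤ T.card)
    (h3 : ∀ s ∈ S, ¬ InCycleOfLength G s 3)
    (h5 : ∀ s ∈ S, ¬ InCycleOfLength G s 5)
    (h7 : ∀ s ∈ S, ¬ InCycleOfLength G s 7)
    (hcard : 8 * S.ncard = 3 * Fintype.card V) : AuxHasPerfectMatching G S := by
  classical
  let t : ↥(removedEdges G S) → Finset ↥S :=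
    fun e => Finset.univ.filter (fun s => auxAdj G (s : V) (e : Sym2 V))
  have hH : ∀ F : Finset ↥(removedEdges G S), F.card ≤ (F.biUnion t).card := by
    intro F
    have := hall_cond G S hcubic hind hM h3 h5 h7
      (F.map (Function.Embedding.subtype _)) (by
        intro e he
        obtain ⟨e', _, rfl⟩ := Finset.mem_map.1 he
        exact e'.2)
      ((F.biUnion t).map (Function.Embedding.subtype _)) (by
        intro e he s hs hse
        obtain ⟨e', he', rfl⟩ := Finset.mem_map.1 he
        refine Finset.mem_map.2 ⟨⟨s, hs⟩, Finset.mem_biUnion.2 ⟨e', he', ?_⟩, rfl⟩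
        exact Finset.mem_filter.2 ⟨Finset.mem_univ _, hse⟩) (by
        intro s hs
        obtain ⟨s', _, rfl⟩ := Finset.mem_map.1 hs
        exact s'.2)
    simpa only [Finset.card_map] using this
  obtain ⟨f, hf, hft⟩ := (Finset.all_card_le_biUnion_card_iff_exists_injective t).1 hH
  have hc : Fintype.card ↥(removedEdges G S) = Fintype.card ↥S := by
    rw [← Nat.card_eq_fintype_card, ← Nat.card_eq_fintype_card, Nat.card_coe_set_eq,
      Nat.card_coe_set_eq]
    exact removed_card G S hcubic hind hcard
  let m := Equiv.ofBijective f ((Fintype.bijective_iff_injective_and_card f).2 ⟨hf, hc⟩)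
  refine ⟨m.symm, fun s => ?_⟩
  have := (Finset.mem_filter.1 (hft (m.symm s))).2
  have hms : f (m.symm s) = s := m.apply_symm_apply s
  rwa [hms] at this

theorem decomp_of_pm (hcubic : G.IsRegularOfDegree 3) (hind : IsIndepSetIn G S)
    (h3 : ∀ s ∈ S, ¬ InCycleOfLength G s 3)
    (hpm : AuxHasPerfectMatching G S) : IsDSSDecomposable G 3 S := by
  obtain ⟨m, hm⟩ := hpm
  have key : ∀ s : ↥S, ∃ t : DoubleStarCopy V 3, t.center = s ∧ t.IsCopyIn G ∧
      ∀ e, e ∈ t.edges ↔ e = (m s : Sym2 V) ∨ e ∈ G.incidenceSet (s : V) := by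
    intro s
    obtain ⟨w, hw, hsw⟩ := hm s
    obtain ⟨x, hx⟩ := Sym2.mem_iff_exists.1 hw
    have hL := (m s).2
    rw [hx] at hL
    have hwx : G.Adj w x := hL.1
    have hxS : x ∉ S := hL.2 x (by simp)
    have hsx : ¬ G.Adj s x := fun h => h3 s s.2 (cyc3 G s w x hsw hwx h.symm)
    have hc : ((G.neighborFinset s).erase w).card = 2 := by
      rw [Finset.card_erase_of_mem (by simpa using hsw), G.card_neighborFinset_eq_degree,
        hcubic s]
    obtain ⟨a, b, hab, hE⟩ := Finset.card_eq_two.1 hc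
    have hadj : ∀ y, G.Adj s y ↔ y = w ∨ y = a ∨ y = b := by
      intro y
      have h1 := congrArg (y ∈ ·) hE
      simp at h1
      by_cases hyw : y = w
      · subst hyw; simp [hsw]
      · simpa [hyw] using h1
    have ha := (hadj a).2 (by simp)
    have hb := (hadj b).2 (by simp)
    have haw : a ≠ w := by
      have : a ∈ (G.neighborFinset s).erase w := by rw [hE]; simp
      exact (Finset.mem_erase.1 this).1
    have hbw : b ≠ w := by
      have : b ∈ (G.neighborFinset s).erase w := by rw [hE]; simp
      exact (Finset.mem_erase.1 this).1
    have hed : ∀ e, e ∈ (DoubleStarCopy.edges (⟨s, w, x, ![a, b]⟩ : DoubleStarCopy V 3)) ↔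
        e = (m s : Sym2 V) ∨ e ∈ G.incidenceSet (s : V) := by
      intro e
      have h1 : e ∈ G.incidenceSet (s : V) ↔ e = s((s : V), w) ∨ e = s((s : V), a) ∨ e = s((s : V), b) := by
        constructor
        · rintro ⟨he, hse⟩
          obtain ⟨y, rfl⟩ := Sym2.mem_iff_exists.1 hse
          rcases (hadj y).1 he with rfl | rfl | rfl <;> simp
        · rintro (rfl | rfl | rfl)
          · exact ⟨hsw, by simp⟩
          · exact ⟨ha, by simp⟩
          · exact ⟨hb, by simp⟩
      have h2 : (∃ i : Fin 2, s((s : V), (![a, b] : Fin 2 → V) i) = e) ↔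
          e = s((s : V), a) ∨ e = s((s : V), b) := by
        rw [Fin.exists_fin_two]
        simp [eq_comm]
      have h3 : e ∈ (DoubleStarCopy.edges (⟨s, w, x, ![a, b]⟩ : DoubleStarCopy V 3)) ↔
          e = s((s : V), w) ∨ e = s(w, x) ∨
            (∃ i : Fin 2, s((s : V), (![a, b] : Fin 2 → V) i) = e) := Iff.rfl
      rw [h3, h2, h1, hx]
      exact or_left_comm
    refine ⟨⟨s, w, x, ![a, b]⟩, rfl, ⟨?_, ?_⟩, hed⟩
    · have : DoubleStarCopy.vertList (⟨s, w, x, ![a, b]⟩ : DoubleStarCopy V 3)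
          = [(s : V), w, x, a, b] := rfl
      rw [this]
      have n1 := hsw.ne
      have n2 := hwx.ne
      have n3 : (s : V) ≠ x := fun h => hxS (h ▸ s.2)
      have n4 := ha.ne
      have n5 := hb.ne
      have n6 : x ≠ a := by rintro rfl; exact hsx ha
      have n7 : x ≠ b := by rintro rfl; exact hsx hb
      simp [n1, n2, n3, n4, n5, n6, n7, haw.symm, hbw.symm, hab]
    · intro e he
      rcases (hed e).1 he with h | h
      · rw [h]; exact (m s).2.1
      · exact h.1
  choose T hTc hTi hTe using key
  refine ⟨Set.range T, ⟨?_, ?_⟩, ?_⟩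
  · rintro _ ⟨s, rfl⟩
    exact hTi s
  · intro e he
    by_cases hL : e ∈ removedEdges G S
    · refine ⟨T (m.symm ⟨e, hL⟩), ⟨⟨_, rfl⟩, ?_⟩, ?_⟩
      · rw [hTe]; left; simp
      · rintro _ ⟨⟨s, rfl⟩, hs⟩
        rw [hTe] at hs
        rcases hs with h | h
        · have : (⟨e, hL⟩ : ↥(removedEdges G S)) = m s := Subtype.ext h
          rw [this]; simp
        · exact absurd s.2 (hL.2 s h.2)
    · have : ∃ s ∈ S, s ∈ e := by
        by_contra hcon
        push Not at hcon
        exact hL ⟨he, fun v hv hvS => hcon v hvS hv⟩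
      obtain ⟨s, hs, hse⟩ := this
      refine ⟨T ⟨s, hs⟩, ⟨⟨_, rfl⟩, ?_⟩, ?_⟩
      · rw [hTe]; right; exact ⟨he, hse⟩
      · rintro _ ⟨⟨s', rfl⟩, hs'⟩
        rw [hTe] at hs'
        rcases hs' with h | h
        · exact absurd (m s').2 (h ▸ hL)
        · have : (s' : V) = s := by
            by_contra hne
            have h2 : e = s((s' : V), s) := (Sym2.mem_and_mem_iff hne).1 ⟨h.2, hse⟩
            rw [h2] at he
            exact hind s'.2 hs he
          congr 1
          exact Subtype.ext this
  · ext v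
    constructor
    · intro hv
      exact ⟨T ⟨v, hv⟩, ⟨_, rfl⟩, hTc _⟩
    · rintro ⟨_, ⟨s, rfl⟩, rfl⟩
      rw [hTc]
      exact s.2

end

/-- Let `G` be a cubic graph of order `n` with `α(G) = 3n/8`.  If there is
an independent set `S` of size `3n/8` no vertex of which lies on a cycle of length 3, 5
or 7, then `G` is `(S_{1,2}, S)`-decomposable. -/
theorem statement6 {V : Type*} [Fintype V] (G : SimpleGraph V) [DecidableRel G.Adj]
    (n : ℕ) (hn : Fintype.card V = n) (hcubic : G.IsRegularOfDegree 3)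
    (halpha : 8 * indepNumber G = 3 * n)
    (S : Set V) (hind : IsIndepSetIn G S) (hcard : 8 * S.ncard = 3 * n)
    (hcycfree : ∀ s ∈ S, ∀ k ∈ ({3, 5, 7} : Set ℕ), ¬ InCycleOfLength G s k) :
    IsDSSDecomposable G 3 S := by
  classical
  subst hn
  have hmax : indepNumber G = S.ncard := by omega
  have h3 : ∀ s ∈ S, ¬ InCycleOfLength G s 3 := fun s hs => hcycfree s hs 3 (by simp)
  have h5 : ∀ s ∈ S, ¬ InCycleOfLength G s 5 := fun s hs => hcycfree s hs 5 (by simp)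
  have h7 : ∀ s ∈ S, ¬ InCycleOfLength G s 7 := fun s hs => hcycfree s hs 7 (by simp)
  exact decomp_of_pm G S hcubic hind h3
    (exists_pm G S hcubic hind (exch G S hind hmax) h3 h5 h7 hcard)
end
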